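/- arXiv:0803.2469 — 7 statements merged into one kernel-verified Lean document; each statement's English description precedes it below -/
import Mathlib

section
/- Let 𝓜 be a finite nonempty index set with cell measures |K| > 0 for K ∈ 𝓜, let δt > 0, and let F : 𝓜 × 𝓜 → ℝ be antisymmetric (F(K,L) = −F(L,K) for all K, L). Let (ρ*_K)_{K∈𝓜} and (ρ_K)_{K∈𝓜} be families of positive real numbers satisfying, for every K ∈ 𝓜, the discrete mass balance (|K|/δt)(ρ_K − ρ*_K) + Σ_{L∈𝓜} F(K,L) = 0. Then for any two families of real numbers (s*_K)_{K∈𝓜} and (s_K)_{K∈𝓜}, the following stability inequality holds: Σ_{K∈𝓜} s_K [ (|K|/δt)(ρ_K s_K − ρ*_K s*_K) + Σ_{L∈𝓜} F(K,L) (s_K + s_L)/2 ] ≥ (1/2) Σ_{K∈𝓜} (|K|/δt) (ρ_K s_K² − ρ*_K (s*_K)²). -/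
/-- An antisymmetric kernel summed against a symmetric one vanishes. -/
theorem sum_antisymm_mul_symm_eq_zero {M : Type*} [Fintype M] (F G : M → M → ℝ)
    (hF : ∀ K L, F K L = - F L K) (hG : ∀ K L, G K L = G L K) :
    ∑ K, ∑ L, F K L * G K L = 0 := by
  have h : ∑ K, ∑ L, F K L * G K L = - ∑ K, ∑ L, F K L * G K L := by
    conv_lhs => rw [Finset.sum_comm]
    simp only [← Finset.sum_neg_distrib]
    refine Finset.sum_congr rfl fun K _ => Finset.sum_congr rfl fun L _ => ?_
    rw [hF L K, hG L K, neg_mul]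
  linarith

/-- Stability of a finite volume advection operator (Theorem 2.1 of the paper).
Given positive families `ρ*`, `ρ` satisfying the discrete mass balance with
antisymmetric fluxes `F`, the discrete advection operator is stable with
respect to the kinetic-energy-like quantity. -/
theorem fv_advection_stability
    {M : Type*} [Fintype M] [Nonempty M]
    (vol : M → ℝ) (hvol : ∀ K, 0 < vol K)
    (δt : ℝ) (hδt : 0 < δt)
    (F : M → M → ℝ) (hF : ∀ K L, F K L = - F L K)
    (ρstar ρ : M → ℝ) (hρstar : ∀ K, 0 < ρstar K) (hρ : ∀ K, 0 < ρ K)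
    (hmass : ∀ K, vol K / δt * (ρ K - ρstar K) + ∑ L, F K L = 0)
    (sstar s : M → ℝ) :
    ∑ K, s K * (vol K / δt * (ρ K * s K - ρstar K * sstar K)
        + ∑ L, F K L * (s K + s L) / 2)
      ≥ (1 / 2) * ∑ K, vol K / δt * (ρ K * s K ^ 2 - ρstar K * sstar K ^ 2) := by
  have hzero := sum_antisymm_mul_symm_eq_zero F (fun K L => s K * s L) hF
    fun K L => mul_comm _ _
  have key : ∀ K, s K * (vol K / δt * (ρ K * s K - ρstar K * sstar K)
        + ∑ L, F K L * (s K + s L) / 2)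
      = 1 / 2 * (vol K / δt * (ρ K * s K ^ 2 - ρstar K * sstar K ^ 2))
        + 1 / 2 * (vol K / δt * ρstar K * (s K - sstar K) ^ 2)
        + 1 / 2 * ∑ L, F K L * (s K * s L) := by
    intro K
    have hflux : s K * ∑ L, F K L * (s K + s L) / 2
        = s K ^ 2 / 2 * ∑ L, F K L + 1 / 2 * ∑ L, F K L * (s K * s L) := by
      simp only [Finset.mul_sum, ← Finset.sum_add_distrib]
      exact Finset.sum_congr rfl fun L _ => by ring
    rw [mul_add, hflux]
    linear_combination s K ^ 2 / 2 * hmass K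
  have hnonneg : 0 ≤ ∑ K, vol K / δt * ρstar K * (s K - sstar K) ^ 2 :=
    Finset.sum_nonneg fun K _ =>
      mul_nonneg (mul_pos (div_pos (hvol K) hδt) (hρstar K)).le (sq_nonneg _)
  simp only [key, Finset.sum_add_distrib, ← Finset.mul_sum]
  linarith
end

section
/- Let C be an open convex subset of ℝ² and f : C → ℝ a convex continuously differentiable function. Let 𝓜 be a finite nonempty index set with cell measures |K| > 0, let δt > 0, and let v : 𝓜 × 𝓜 → ℝ be antisymmetric. Let (ρ_K), (ρ*_K), (z_K), (z*_K) be four families of real numbers with (ρ_K, z_K) ∈ C and (ρ*_K, z*_K) ∈ C for all K ∈ 𝓜, satisfying for every K ∈ 𝓜 the two upwind discrete balances (|K|/δt)(ρ_K − ρ*_K) + Σ_{L∈𝓜} [ v(K,L)⁺ ρ_K − v(K,L)⁻ ρ_L ] = 0 and (|K|/δt)(z_K − z*_K) + Σ_{L∈𝓜} [ v(K,L)⁺ z_K − v(K,L)⁻ z_L ] = 0, where v(K,L)⁺ = max(v(K,L),0) and v(K,L)⁻ = −min(v(K,L),0). Define, for each K ∈ 𝓜, p_K = ρ_K ∂f/∂ρ(ρ_K,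 z_K) + z_K ∂f/∂z(ρ_K, z_K) − f(ρ_K, z_K). Then Σ_{K∈𝓜} (−p_K) · Σ_{L∈𝓜} v(K,L) ≥ Σ_{K∈𝓜} |K| ( f(ρ_K, z_K) − f(ρ*_K, z*_K) ) / δt. -/
/-- The tangent hyperplane of a convex function lies below its graph. -/
theorem ConvexOn.add_fderiv_sub_le {E : Type*} [NormedAddCommGroup E] [NormedSpace ℝ E]
    {C : Set E} {f : E → ℝ} (hf : ConvexOn ℝ C f) {x y : E} (hx : x ∈ C) (hy : y ∈ C)
    (hd : DifferentiableAt ℝ f x) :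
    f x + fderiv ℝ f x (y - x) ≤ f y := by
  have hderiv : HasDerivAt (f ∘ AffineMap.lineMap x y) (fderiv ℝ f x (y - x)) (0 : ℝ) := by
    have hfx : HasFDerivAt f (fderiv ℝ f x) (AffineMap.lineMap x y (0 : ℝ)) := by
      simpa using hd.hasFDerivAt
    exact hfx.comp_hasDerivAt 0 AffineMap.hasDerivAt_lineMap
  have hslope := (hf.comp_affineMap (AffineMap.lineMap x y)).le_slope_of_hasDerivAt
    (x := 0) (y := 1) (by simpa using hx) (by simpa using hy) one_pos hderiv
  simp only [slope_def_field, Function.comp_apply, AffineMap.lineMap_apply_zero,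
    AffineMap.lineMap_apply_one, sub_zero, div_one] at hslope
  linarith

/-- On `ℝ × ℝ`, the tangent plane inequality in terms of partial derivatives. -/
theorem ConvexOn.add_partial_derivs_le {C : Set (ℝ × ℝ)} {f : ℝ × ℝ → ℝ}
    (hf : ConvexOn ℝ C f) {r z r' z' : ℝ} (hx : (r, z) ∈ C) (hy : (r', z') ∈ C)
    (hd : DifferentiableAt ℝ f (r, z)) :
    f (r, z) + ((r' - r) * fderiv ℝ f (r, z) (1, 0) + (z' - z) * fderiv ℝ f (r, z) (0, 1))
      ≤ f (r', z') := by
  have hdecomp : ((r', z') - (r, z) : ℝ × ℝ)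
      = (r' - r) • ((1, 0) : ℝ × ℝ) + (z' - z) • ((0, 1) : ℝ × ℝ) := by
    ext <;> simp
  have h := hf.add_fderiv_sub_le hx hy hd
  rwa [hdecomp, map_add, map_smul, map_smul, smul_eq_mul, smul_eq_mul] at h

/-- Upwind fluxes of an antisymmetric velocity field are conservative. -/
theorem sum_upwind_flux_eq_zero {M : Type*} [Fintype M] {v : M → M → ℝ}
    (hv : ∀ K L, v K L = - v L K) (g : M → ℝ) :
    ∑ K, ∑ L, (max (v K L) 0 * g K - (- min (v K L) 0) * g L) = 0 := by
  simp only [Finset.sum_sub_distrib]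
  rw [sub_eq_zero, Finset.sum_comm]
  refine Finset.sum_congr rfl fun K _ => Finset.sum_congr rfl fun L _ => ?_
  rw [hv L K, ← neg_zero, max_neg_neg, neg_zero]


/-- Stability due to the pressure work (Theorem 3.1 of the paper).
Given a convex continuously differentiable free energy `f` on an open convex
set `C ⊆ ℝ²`, and families `(ρ_K, z_K)`, `(ρ*_K, z*_K)` in `C` satisfying the
upwind discrete mass and gas mass balances, the work of the pressure forces is
bounded below by the discrete time derivative of the free energy. -/
theorem pressure_work_stability
    {M : Type*} [Fintype M] [Nonempty M]
    (C : Set (ℝ × ℝ)) (hCopen : IsOpen C) (hCconv : Convex ℝ C)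
    (f : ℝ × ℝ → ℝ) (hfconv : ConvexOn ℝ C f) (hfdiff : ContDiffOn ℝ 1 f C)
    (vol : M → ℝ) (hvol : ∀ K, 0 < vol K)
    (δt : ℝ) (hδt : 0 < δt)
    (v : M → M → ℝ) (hv : ∀ K L, v K L = - v L K)
    (ρ ρstar z zstar : M → ℝ)
    (hmem : ∀ K, (ρ K, z K) ∈ C) (hmemstar : ∀ K, (ρstar K, zstar K) ∈ C)
    (hρbal : ∀ K, vol K / δt * (ρ K - ρstar K)
        + ∑ L, (max (v K L) 0 * ρ K - (- min (v K L) 0) * ρ L) = 0)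
    (hzbal : ∀ K, vol K / δt * (z K - zstar K)
        + ∑ L, (max (v K L) 0 * z K - (- min (v K L) 0) * z L) = 0)
    (p : M → ℝ)
    (hp : ∀ K, p K = ρ K * fderiv ℝ f (ρ K, z K) (1, 0)
        + z K * fderiv ℝ f (ρ K, z K) (0, 1) - f (ρ K, z K)) :
    ∑ K, (- p K) * ∑ L, v K L
      ≥ ∑ K, vol K * (f (ρ K, z K) - f (ρstar K, zstar K)) / δt := by
  have hd : ∀ K, DifferentiableAt ℝ f (ρ K, z K) := fun K =>
    (hfdiff.differentiableOn one_ne_zero).differentiableAt (hCopen.mem_nhds (hmem K))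
  have hcell : ∀ K, vol K * (f (ρ K, z K) - f (ρstar K, zstar K)) / δt
      ≤ (- p K) * ∑ L, v K L
        - ∑ L, (max (v K L) 0 * f (ρ K, z K) - (- min (v K L) 0) * f (ρ L, z L)) := by
    intro K
    set a := fderiv ℝ f (ρ K, z K) (1, 0) with ha
    set b := fderiv ℝ f (ρ K, z K) (0, 1) with hb
    have htime : vol K * (f (ρ K, z K) - f (ρstar K, zstar K)) / δt
        ≤ vol K / δt * (ρ K - ρstar K) * a + vol K / δt * (z K - zstar K) * b := by
      have htangent := hfconv.add_partial_derivs_le (hmem K) (hmemstar K) (hd K)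
      rw [← ha, ← hb] at htangent
      have hscaled := mul_le_mul_of_nonneg_left htangent (div_pos (hvol K) hδt).le
      rw [mul_div_right_comm]
      linarith
    have hflux : p K * ∑ L, v K L
        + ∑ L, (max (v K L) 0 * f (ρ K, z K) - (- min (v K L) 0) * f (ρ L, z L))
        ≤ (∑ L, (max (v K L) 0 * ρ K - (- min (v K L) 0) * ρ L)) * a
          + (∑ L, (max (v K L) 0 * z K - (- min (v K L) 0) * z L)) * b := by
      rw [Finset.mul_sum, Finset.sum_mul, Finset.sum_mul, ← Finset.sum_add_distrib,
        ← Finset.sum_add_distrib]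
      refine Finset.sum_le_sum fun L _ => ?_
      have htangent := hfconv.add_partial_derivs_le (hmem K) (hmem L) (hd K)
      rw [← ha, ← hb] at htangent
      have hscaled := mul_le_mul_of_nonneg_left htangent
        (neg_nonneg.2 (min_le_right (v K L) 0))
      have hsplit : v K L = max (v K L) 0 + min (v K L) 0 := by
        rw [max_add_min, add_zero]
      have hpv : p K * v K L
          = (ρ K * a + z K * b - f (ρ K, z K)) * (max (v K L) 0 + min (v K L) 0) := by
        rw [← hsplit, hp K]
      rw [hpv]
      linarith
    linear_combination htime + hflux + a * hρbal K + b * hzbal K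
  have hsum := Finset.sum_le_sum fun K (_ : K ∈ Finset.univ) => hcell K
  rwa [Finset.sum_sub_distrib, sum_upwind_flux_eq_zero hv fun K => f (ρ K, z K), sub_zero]
    at hsum
end

section
/- Let C be an open convex subset of ℝ², let f : C → ℝ be a convex continuously differentiable function, and let (ρ₁, z₁) and (ρ₂, z₂) be two distinct points of C. Then there exists ζ ∈ [0,1] such that the point (ρ̄, z̄) = (1−ζ)(ρ₁, z₁) + ζ(ρ₂, z₂) satisfies f(ρ₁,z₁) + ∂f/∂ρ(ρ₁,z₁)(ρ̄−ρ₁) + ∂f/∂z(ρ₁,z₁)(z̄−z₁) = f(ρ₂,z₂) + ∂f/∂ρ(ρ₂,z₂)(ρ̄−ρ₂) + ∂f/∂z(ρ₂,z₂)(z̄−z₂). In addition, the quantity T = (ρ₁−ρ̄)[∂f/∂ρ(ρ₁,z₁) − ∂f/∂ρ(ρ₂,z₂)] + (z₁−z̄)[∂f/∂z(ρ₁,z₁) − ∂f/∂z(ρ₂,z₂)] is nonnegative. -/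
open AffineMap in
/-- A convex function lies above its tangent hyperplanes. -/
theorem ConvexOn.add_fderiv_apply_sub_le {E : Type*} [NormedAddCommGroup E] [NormedSpace ℝ E]
    {s : Set E} {f : E → ℝ} {f' : E →L[ℝ] ℝ} {x y : E} (hf : ConvexOn ℝ s f)
    (hx : x ∈ s) (hy : y ∈ s) (hf' : HasFDerivAt f f' x) :
    f x + f' (y - x) ≤ f y := by
  have hline : ConvexOn ℝ (lineMap (k := ℝ) x y ⁻¹' s) (f ∘ lineMap (k := ℝ) x y) :=
    hf.comp_affineMap _
  have hderiv : HasDerivAt (f ∘ lineMap (k := ℝ) x y) (f' (y - x)) 0 :=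
    HasFDerivAt.comp_hasDerivAt (0 : ℝ) (by simpa using hf') hasDerivAt_lineMap
  have hslope := hline.le_slope_of_hasDerivAt (x := 0) (y := 1)
    (by simpa using hx) (by simpa using hy) one_pos hderiv
  have hle : f' (y - x) ≤ f y - f x := by simpa [slope_def_field] using hslope
  linarith


/-- Lemma 3.2 of the paper. For a convex continuously differentiable function
`f` on an open convex set `C ⊆ ℝ²` and two distinct points `(ρ₁, z₁)` and
`(ρ₂, z₂)` of `C`, there exists a point `(ρ̄, z̄)` on the segment joining them
at which the two first-order Taylor expansions agree; moreover the associated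
quantity `T` is nonnegative. -/
theorem interface_point_exists
    (C : Set (ℝ × ℝ)) (hCopen : IsOpen C) (hCconv : Convex ℝ C)
    (f : ℝ × ℝ → ℝ) (hfconv : ConvexOn ℝ C f) (hfdiff : ContDiffOn ℝ 1 f C)
    (ρ₁ z₁ ρ₂ z₂ : ℝ) (h₁ : (ρ₁, z₁) ∈ C) (h₂ : (ρ₂, z₂) ∈ C)
    (hne : (ρ₁, z₁) ≠ (ρ₂, z₂)) :
    ∃ ζ ∈ Set.Icc (0 : ℝ) 1,
      (f (ρ₁, z₁)
          + fderiv ℝ f (ρ₁, z₁) (1, 0) * (((1 - ζ) * ρ₁ + ζ * ρ₂) - ρ₁)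
          + fderiv ℝ f (ρ₁, z₁) (0, 1) * (((1 - ζ) * z₁ + ζ * z₂) - z₁)
        = f (ρ₂, z₂)
          + fderiv ℝ f (ρ₂, z₂) (1, 0) * (((1 - ζ) * ρ₁ + ζ * ρ₂) - ρ₂)
          + fderiv ℝ f (ρ₂, z₂) (0, 1) * (((1 - ζ) * z₁ + ζ * z₂) - z₂))
      ∧ 0 ≤ (ρ₁ - ((1 - ζ) * ρ₁ + ζ * ρ₂))
              * (fderiv ℝ f (ρ₁, z₁) (1, 0) - fderiv ℝ f (ρ₂, z₂) (1, 0))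
          + (z₁ - ((1 - ζ) * z₁ + ζ * z₂))
              * (fderiv ℝ f (ρ₁, z₁) (0, 1) - fderiv ℝ f (ρ₂, z₂) (0, 1)) := by
  have hd : ∀ p ∈ C, HasFDerivAt f (fderiv ℝ f p) p := fun p hp =>
    ((hfdiff.differentiableOn one_ne_zero).differentiableAt (hCopen.mem_nhds hp)).hasFDerivAt
  have hcoord : ∀ (L : ℝ × ℝ →L[ℝ] ℝ) (a b : ℝ), L (a, b) = L (1, 0) * a + L (0, 1) * b := by
    intro L a b
    have h : ((a, b) : ℝ × ℝ) = a • (1, 0) + b • (0, 1) := by simp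
    rw [h, map_add, map_smul, map_smul, smul_eq_mul, smul_eq_mul]
    ring
  have h12 := hfconv.add_fderiv_apply_sub_le h₁ h₂ (hd _ h₁)
  have h21 := hfconv.add_fderiv_apply_sub_le h₂ h₁ (hd _ h₂)
  rw [Prod.mk_sub_mk, hcoord] at h12 h21
  generalize fderiv ℝ f (ρ₁, z₁) (1, 0) = a₁ at *
  generalize fderiv ℝ f (ρ₁, z₁) (0, 1) = b₁ at *
  generalize fderiv ℝ f (ρ₂, z₂) (1, 0) = a₂ at *
  generalize fderiv ℝ f (ρ₂, z₂) (0, 1) = b₂ at *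
  generalize f (ρ₁, z₁) = u₁ at *
  generalize f (ρ₂, z₂) = u₂ at *
  obtain ⟨B, hB⟩ : ∃ B, B = u₁ - (u₂ + (a₂ * (ρ₁ - ρ₂) + b₂ * (z₁ - z₂))) := ⟨_, rfl⟩
  obtain ⟨D, hD⟩ : ∃ D, D = (a₂ - a₁) * (ρ₂ - ρ₁) + (b₂ - b₁) * (z₂ - z₁) := ⟨_, rfl⟩
  have hB0 : 0 ≤ B := by linarith
  have hBD : B ≤ D := by linarith
  have hζ : B / D * D = B := div_mul_cancel_of_imp fun h => by linarith
  have hζ0 : 0 ≤ B / D := div_nonneg hB0 (hB0.trans hBD)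
  refine ⟨B / D, ⟨hζ0, div_le_one_of_le₀ hBD (hB0.trans hBD)⟩, ?_, ?_⟩
  · generalize B / D = ζ at *
    subst hB hD
    linear_combination -hζ
  · have hT := mul_nonneg hζ0 (hB0.trans hBD)
    generalize B / D = ζ at *
    subst hD
    linarith
end

section
/- Let ρℓ > 0 and a > 0 be real constants. The function f(ρ, z) = a² z log( z ρℓ / (z + ρℓ − ρ) ) is convex on the open convex set C = {(ρ, z) ∈ ℝ² : ρ > 0, z > 0, z − ρ + ρℓ > 0}. -/
/-- The function `(x, u) ↦ x log (x c / u)` lies above its tangent plane at `(X, U)`. -/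
theorem mul_log_mul_div_ge_tangent {c x u X U : ℝ} (hc : 0 < c) (hx : 0 < x) (hu : 0 < u)
    (hX : 0 < X) (hU : 0 < U) :
    x * Real.log (X * c / U) + x - u * (X / U) ≤ x * Real.log (x * c / u) := by
  have hlog : Real.log (x * c / u) = Real.log (X * c / U) - Real.log (X * u / (U * x)) := by
    rw [← Real.log_div (by positivity) (by positivity)]
    congr 1
    field_simp
  have hle : Real.log (X * u / (U * x)) ≤ X * u / (U * x) - 1 :=
    Real.log_le_sub_one_of_pos (by positivity)
  have hmul := mul_le_mul_of_nonneg_left hle hx.le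
  have hcancel : x * (X * u / (U * x) - 1) = u * (X / U) - x := by
    field_simp
  rw [hlog]
  linarith

/-- The set of admissible partial densities is convex. -/
theorem convex_admissible_densities (ρℓ : ℝ) :
    Convex ℝ {p : ℝ × ℝ | 0 < p.1 ∧ 0 < p.2 ∧ 0 < p.2 - p.1 + ρℓ} := by
  have h₁ : Convex ℝ {p : ℝ × ℝ | 0 < p.1} :=
    convex_halfSpace_gt (LinearMap.fst ℝ ℝ ℝ).isLinear 0
  have h₂ : Convex ℝ {p : ℝ × ℝ | 0 < p.2} :=
    convex_halfSpace_gt (LinearMap.snd ℝ ℝ ℝ).isLinear 0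
  have h₃ : Convex ℝ {p : ℝ × ℝ | -ρℓ < p.2 - p.1} :=
    convex_halfSpace_gt (LinearMap.snd ℝ ℝ ℝ - LinearMap.fst ℝ ℝ ℝ).isLinear (-ρℓ)
  convert h₁.inter (h₂.inter h₃) using 1
  ext p
  simp only [Set.mem_ofPred_eq, Set.mem_inter_iff, neg_lt_iff_pos_add]

/-- Convexity of the volumetric free energy of the mixture (section 3.2 of the
paper): `f(ρ, z) = a² z log(z ρℓ / (z + ρℓ − ρ))` is convex on
`C = {(ρ, z) : ρ > 0, z > 0, z − ρ + ρℓ > 0}`. -/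
theorem free_energy_convex
    (ρℓ a : ℝ) (hρℓ : 0 < ρℓ) (ha : 0 < a) :
    ConvexOn ℝ
      {p : ℝ × ℝ | 0 < p.1 ∧ 0 < p.2 ∧ 0 < p.2 - p.1 + ρℓ}
      (fun p : ℝ × ℝ => a ^ 2 * p.2 * Real.log (p.2 * ρℓ / (p.2 + ρℓ - p.1))) := by
  refine ⟨convex_admissible_densities ρℓ, fun p hp q hq s t hs ht hst => ?_⟩
  obtain ⟨-, hZ, hW⟩ := convex_admissible_densities ρℓ hp hq hs ht hst
  obtain ⟨-, hp₂, hp₃⟩ := hp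
  obtain ⟨-, hq₂, hq₃⟩ := hq
  simp only [Prod.fst_add, Prod.snd_add, Prod.smul_fst, Prod.smul_snd, smul_eq_mul] at hZ hW ⊢
  set Z := s * p.2 + t * q.2 with hZ_def
  set W := Z + ρℓ - (s * p.1 + t * q.1) with hW_def
  have hW' : 0 < W := by linarith
  have hp_tangent := mul_le_mul_of_nonneg_left (mul_log_mul_div_ge_tangent hρℓ hp₂
    (show 0 < p.2 + ρℓ - p.1 by linarith) hZ hW') hs
  have hq_tangent := mul_le_mul_of_nonneg_left (mul_log_mul_div_ge_tangent hρℓ hq₂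
    (show 0 < q.2 + ρℓ - q.1 by linarith) hZ hW') ht
  have hW_comb : s * (p.2 + ρℓ - p.1) + t * (q.2 + ρℓ - q.1) = W := by
    rw [hW_def, hZ_def]
    linear_combination ρℓ * hst
  have hcancel : W * (Z / W) = Z := mul_div_cancel₀ Z hW'.ne'
  have hkey : Z * Real.log (Z * ρℓ / W) ≤
      s * (p.2 * Real.log (p.2 * ρℓ / (p.2 + ρℓ - p.1))) +
        t * (q.2 * Real.log (q.2 * ρℓ / (q.2 + ρℓ - q.1))) := by
    refine le_trans (le_of_eq ?_) (add_le_add hp_tangent hq_tangent)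
    linear_combination (Real.log (Z * ρℓ / W) + 1) * hZ_def + (Z / W) * hW_comb + hcancel
  have hscaled := mul_le_mul_of_nonneg_left hkey (sq_nonneg a)
  linarith
end

section
/- Let ρℓ > 0 and a > 0 be real constants, let f(ρ, z) = a² z log( z ρℓ / (z + ρℓ − ρ) ) on the open set C = {(ρ, z) ∈ ℝ² : ρ > 0, z > 0, z − ρ + ρℓ > 0}, and let h(ρ, z) = ∂f/∂z(ρ, z). Then h depends only on the pressure: for every (ρ, z) ∈ C, h(ρ, z) = h_p(℘(ρ, z)), where ℘(ρ, z) = a² z ρℓ / (z + ρℓ − ρ) and h_p : (0, ∞) → ℝ is given by h_p(p) = a² [ log(p/a²) + (ρℓ − p/a²)/ρℓ ]. -/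
/-- The derivative in `z` of `a² z log(z ρℓ / (z + ρℓ − ρ))` at fixed `ρ`. -/
lemma hasDerivAt_mul_log_gas_density {ρℓ ρ z : ℝ} (a : ℝ) (hρℓ : ρℓ ≠ 0) (hz : z ≠ 0)
    (hD : z + ρℓ - ρ ≠ 0) :
    HasDerivAt (fun t : ℝ => a ^ 2 * t * Real.log (t * ρℓ / (t + ρℓ - ρ)))
      (a ^ 2 * (Real.log (z * ρℓ / (z + ρℓ - ρ)) + (1 - z / (z + ρℓ - ρ)))) z := by
  have hnum : HasDerivAt (fun t : ℝ => t * ρℓ) (1 * ρℓ) z := (hasDerivAt_id z).mul_const ρℓ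
  have hden : HasDerivAt (fun t : ℝ => t + ρℓ - ρ) 1 z :=
    ((hasDerivAt_id z).add_const ρℓ).sub_const ρ
  have hlog := (hnum.fun_div hden hD).log (div_ne_zero (mul_ne_zero hz hρℓ) hD)
  have hlin : HasDerivAt (fun t : ℝ => a ^ 2 * t) (a ^ 2 * 1) z :=
    (hasDerivAt_id z).const_mul (a ^ 2)
  refine (hlin.fun_mul hlog).congr_deriv ?_
  field_simp

/-- First part of Lemma 4.3 of the paper: the partial derivative
`h(ρ, z) = ∂f/∂z(ρ, z)` of the volumetric free energy
`f(ρ, z) = a² z log(z ρℓ / (z + ρℓ − ρ))` depends only on the pressure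
`℘(ρ, z) = a² z ρℓ / (z + ρℓ − ρ)`: it equals `h_p(℘(ρ, z))` with
`h_p(p) = a² [log(p/a²) + (ρℓ − p/a²)/ρℓ]`. -/
theorem dfdz_depends_only_on_pressure
    (ρℓ a : ℝ) (hρℓ : 0 < ρℓ) (ha : 0 < a)
    (f : ℝ × ℝ → ℝ)
    (hf : ∀ p : ℝ × ℝ,
      f p = a ^ 2 * p.2 * Real.log (p.2 * ρℓ / (p.2 + ρℓ - p.1)))
    (hp : ℝ → ℝ)
    (hhp : ∀ p : ℝ, hp p = a ^ 2 * (Real.log (p / a ^ 2) + (ρℓ - p / a ^ 2) / ρℓ))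
    (ρ z : ℝ) (hρ : 0 < ρ) (hz : 0 < z) (hD : 0 < z - ρ + ρℓ) :
    fderiv ℝ f (ρ, z) (0, 1) = hp (a ^ 2 * (z * ρℓ / (z + ρℓ - ρ))) := by
  have hD' : z + ρℓ - ρ ≠ 0 := by linarith
  obtain rfl : f = fun p : ℝ × ℝ =>
      a ^ 2 * p.2 * Real.log (p.2 * ρℓ / (p.2 + ρℓ - p.1)) := funext hf
  have hdiff : DifferentiableAt ℝ (fun p : ℝ × ℝ =>
      a ^ 2 * p.2 * Real.log (p.2 * ρℓ / (p.2 + ρℓ - p.1))) (ρ, z) := by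
    have harg : DifferentiableAt ℝ (fun p : ℝ × ℝ => p.2 * ρℓ / (p.2 + ρℓ - p.1)) (ρ, z) := by
      have hden : DifferentiableAt ℝ (fun p : ℝ × ℝ => p.2 + ρℓ - p.1) (ρ, z) := by fun_prop
      have hnum : DifferentiableAt ℝ (fun p : ℝ × ℝ => p.2 * ρℓ) (ρ, z) := by fun_prop
      simpa only [div_eq_mul_inv] using hnum.fun_mul (hden.fun_inv hD')
    have hlog := harg.log (div_ne_zero (mul_ne_zero hz.ne' hρℓ.ne') hD')
    exact DifferentiableAt.fun_mul (by fun_prop) hlog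
  have hcurve : HasDerivAt (fun t : ℝ => (ρ, t)) ((0, 1) : ℝ × ℝ) z :=
    (hasDerivAt_const z ρ).prodMk (hasDerivAt_id z)
  rw [(hdiff.hasFDerivAt.comp_hasDerivAt z hcurve).unique
    (hasDerivAt_mul_log_gas_density a hρℓ.ne' hz.ne' hD'), hhp,
    mul_div_cancel_left₀ _ (pow_ne_zero 2 ha.ne')]
  congr 2
  field_simp
end

section
/- Let 𝓜 be a finite nonempty index set with cell measures |K| > 0, let δt > 0, and let v : 𝓜 × 𝓜 → ℝ be antisymmetric. Let (x*_K)_{K∈𝓜} and (x_K)_{K∈𝓜} be families of real numbers with x*_K > 0 for all K, satisfying for every K ∈ 𝓜 the upwind balance (|K|/δt)(x_K − x*_K) + Σ_{L∈𝓜} [ v(K,L)⁺ x_K − v(K,L)⁻ x_L ] = 0, where v(K,L)⁺ = max(v(K,L),0) and v(K,L)⁻ = −min(v(K,L),0). Define ‖∇_h·u‖_∞ = max over K ∈ 𝓜 of max( 0, (1/|K|) Σ_{L∈𝓜} v(K,L) ). Then for every K ∈ 𝓜: ( min_{L∈𝓜} x*_L ) / ( 1 + δt ‖∇_h·u‖_∞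 ) ≤ x_K ≤ ( 1 / min_{L∈𝓜} |L| ) · Σ_{L∈𝓜} |L| x*_L. -/
section Upwind

variable {M : Type*} [Fintype M]

/-- The upwind balance, rewritten with the outgoing fluxes only. -/
theorem upwind_balance_outflow
    (vol : M → ℝ) (δt : ℝ) (hδt : 0 < δt)
    (v : M → M → ℝ) (hv : ∀ K L, v K L = - v L K) (xstar x : M → ℝ) (K : M)
    (hbal : vol K / δt * (x K - xstar K)
        + ∑ L, (max (v K L) 0 * x K - (- min (v K L) 0) * x L) = 0) :
    vol K * x K + δt * ∑ L, max (v K L) 0 * x K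
      = vol K * xstar K + δt * ∑ L, max (v L K) 0 * x L := by
  have hneg : ∀ L, - min (v K L) 0 = max (v L K) 0 := fun L => by
    rw [hv L K, ← neg_zero, max_neg_neg, neg_zero]
  simp only [hneg, Finset.sum_sub_distrib] at hbal
  have hmul : δt * (vol K / δt * (x K - xstar K)) = vol K * (x K - xstar K) := by
    field_simp
  linear_combination δt * hbal - hmul

/-- Summation of the outgoing and of the incoming fluxes over all the cells agree. -/
theorem sum_outflow_eq_sum_inflow (v : M → M → ℝ) (y : M → ℝ) :
    ∑ K, ∑ L, max (v K L) 0 * y K = ∑ K, ∑ L, max (v L K) 0 * y L :=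
  Finset.sum_comm

/-- The upwind scheme preserves nonnegativity. -/
theorem upwind_nonneg
    (vol : M → ℝ) (hvol : ∀ K, 0 < vol K) (δt : ℝ) (hδt : 0 < δt)
    (v : M → M → ℝ) (xstar x : M → ℝ) (hxstar : ∀ K, 0 ≤ xstar K)
    (h : ∀ K, vol K * x K + δt * ∑ L, max (v K L) 0 * x K
      = vol K * xstar K + δt * ∑ L, max (v L K) 0 * x L) (K : M) : 0 ≤ x K := by
  have key : ∀ K, vol K * max (-x K) 0 + δt * ∑ L, max (v K L) 0 * max (-x K) 0
      ≤ δt * ∑ L, max (v L K) 0 * max (-x L) 0 := fun K => by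
    rcases le_total 0 (x K) with hK | hK
    · rw [max_eq_right (neg_nonpos.2 hK)]
      simp only [mul_zero, Finset.sum_const_zero, add_zero]
      positivity
    · rw [max_eq_left (neg_nonneg.2 hK)]
      have h1 : ∑ L, max (v L K) 0 * (-x L) ≤ ∑ L, max (v L K) 0 * max (-x L) 0 := by
        gcongr
        exact le_max_left _ _
      have h2 := mul_le_mul_of_nonneg_left h1 hδt.le
      have h3 := mul_nonneg (hvol K).le (hxstar K)
      have h4 := h K
      simp only [mul_neg, Finset.sum_neg_distrib] at h2 ⊢
      linarith
  have hsum := Finset.sum_le_sum fun K (_ : K ∈ Finset.univ) => key K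
  rw [Finset.sum_add_distrib, ← Finset.mul_sum, ← Finset.mul_sum,
    sum_outflow_eq_sum_inflow v fun K => max (-x K) 0] at hsum
  have hle : vol K * max (-x K) 0 ≤ ∑ K, vol K * max (-x K) 0 :=
    Finset.single_le_sum (f := fun K => vol K * max (-x K) 0)
      (fun L _ => mul_nonneg (hvol L).le (le_max_right _ _)) (Finset.mem_univ K)
  have hmax : max (-x K) 0 ≤ 0 := by
    by_contra! hpos
    have := mul_pos (hvol K) hpos
    linarith
  linarith [le_max_left (-x K) 0]

/-- The upwind scheme is conservative. -/
theorem upwind_conservation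
    (vol : M → ℝ) (δt : ℝ) (v : M → M → ℝ) (xstar x : M → ℝ)
    (h : ∀ K, vol K * x K + δt * ∑ L, max (v K L) 0 * x K
      = vol K * xstar K + δt * ∑ L, max (v L K) 0 * x L) :
    ∑ K, vol K * x K = ∑ K, vol K * xstar K := by
  have hsum := Finset.sum_congr rfl fun K (_ : K ∈ Finset.univ) => h K
  rw [Finset.sum_add_distrib, Finset.sum_add_distrib, ← Finset.mul_sum, ← Finset.mul_sum,
    sum_outflow_eq_sum_inflow v x] at hsum
  linarith

end Upwind

/-- Lemma A.1 of the paper. For the upwind discrete advection equation with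
positive initial data `x*`, the solution `x` satisfies the lower bound
`min x* / (1 + δt ‖∇_h·u‖_∞)` and the upper bound `(Σ |L| x*_L) / min |L|`. -/
theorem upwind_bounds
    {M : Type*} [Fintype M] [Nonempty M]
    (vol : M → ℝ) (hvol : ∀ K, 0 < vol K)
    (δt : ℝ) (hδt : 0 < δt)
    (v : M → M → ℝ) (hv : ∀ K L, v K L = - v L K)
    (xstar x : M → ℝ) (hxstar : ∀ K, 0 < xstar K)
    (hbal : ∀ K, vol K / δt * (x K - xstar K)
        + ∑ L, (max (v K L) 0 * x K - (- min (v K L) 0) * x L) = 0) :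
    ∀ K,
      (Finset.univ.inf' Finset.univ_nonempty xstar)
          / (1 + δt * Finset.univ.sup' Finset.univ_nonempty
              (fun K' => max 0 ((1 / vol K') * ∑ L, v K' L)))
        ≤ x K
      ∧ x K ≤ (1 / Finset.univ.inf' Finset.univ_nonempty vol)
          * ∑ L, vol L * xstar L := by
  have h := fun K => upwind_balance_outflow vol δt hδt v hv xstar x K (hbal K)
  have hx := upwind_nonneg vol hvol δt hδt v xstar x (fun K => (hxstar K).le) h
  intro K
  constructor
  · obtain ⟨K₀, hK₀⟩ := Finite.exists_min x
    refine le_trans ?_ (hK₀ K)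
    set D := Finset.univ.sup' Finset.univ_nonempty
      (fun K' => max 0 ((1 / vol K') * ∑ L, v K' L))
    have hDle : max 0 ((1 / vol K₀) * ∑ L, v K₀ L) ≤ D :=
      Finset.le_sup' (fun K' => max 0 ((1 / vol K') * ∑ L, v K' L)) (Finset.mem_univ K₀)
    have hD0 : 0 ≤ D := (le_max_left _ _).trans hDle
    have hdiv : ∑ L, v K₀ L ≤ vol K₀ * D := by
      have := (le_max_right _ _).trans hDle
      rwa [one_div, inv_mul_le_iff₀ (hvol K₀)] at this
    have hin : ∑ L, max (v L K₀) 0 * x K₀ ≤ ∑ L, max (v L K₀) 0 * x L := by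
      gcongr with L
      exact hK₀ L
    have hsplit : ∑ L, max (v K₀ L) 0 * x K₀ - ∑ L, max (v L K₀) 0 * x K₀
        = (∑ L, v K₀ L) * x K₀ := by
      rw [← Finset.sum_sub_distrib, Finset.sum_mul]
      refine Finset.sum_congr rfl fun L _ => ?_
      rw [hv L K₀, ← sub_mul, max_zero_sub_max_neg_zero_eq_self]
    have hflux : δt * (∑ L, max (v K₀ L) 0 * x K₀ - ∑ L, max (v L K₀) 0 * x L)
        ≤ δt * (vol K₀ * D * x K₀) := by
      have := mul_le_mul_of_nonneg_right hdiv (hx K₀)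
      gcongr
      linarith
    have hmin : Finset.univ.inf' Finset.univ_nonempty xstar ≤ xstar K₀ :=
      Finset.inf'_le _ (Finset.mem_univ K₀)
    rw [div_le_iff₀ (by positivity)]
    refine hmin.trans (le_of_mul_le_mul_left ?_ (hvol K₀))
    linarith [h K₀]
  · have hpos : 0 < Finset.univ.inf' Finset.univ_nonempty vol :=
      (Finset.lt_inf'_iff _).2 fun L _ => hvol L
    rw [one_div, le_inv_mul_iff₀ hpos, ← upwind_conservation vol δt v xstar x h]
    calc Finset.univ.inf' Finset.univ_nonempty vol * x K ≤ vol K * x K :=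
          mul_le_mul_of_nonneg_right (Finset.inf'_le _ (Finset.mem_univ K)) (hx K)
      _ ≤ ∑ L, vol L * x L :=
          Finset.single_le_sum (f := fun L => vol L * x L)
            (fun L _ => mul_nonneg (hvol L).le (hx L)) (Finset.mem_univ K)
end

section
/- Let 𝓜 be a finite nonempty index set with cell measures |K| > 0, let δt > 0, and let v : 𝓜 × 𝓜 → ℝ be antisymmetric; write v(K,L)⁺ = max(v(K,L),0) and v(K,L)⁻ = −min(v(K,L),0). Let (ρ*_K), (ρ_K) be families of positive real numbers satisfying for every K ∈ 𝓜 the upwind mass balance (|K|/δt)(ρ_K − ρ*_K) + Σ_{L∈𝓜} [ v(K,L)⁺ ρ_K − v(K,L)⁻ ρ_L ] = 0, and let (x*_K), (x_K) be families of real numbers satisfying for every K ∈ 𝓜 the upwind balance (|K|/δt)(ρ_K x_K − ρ*_K x*_K) + Σ_{L∈𝓜} [ v(K,L)⁺ ρ_K x_K − v(K,L)⁻ ρ_L x_L ] = 0. Then the discrete maximum principle holds: for every K ∈ 𝓜, min_{L∈𝓜} x*_L ≤ x_K ≤ max_{L∈𝓜} x*_L. -/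
/-- Subtracting `x K` times the mass balance from the upwind balance of `ρ x` leaves a balance
that involves only differences of values of `x` and `xstar`. -/
theorem upwind_transport_eq {M : Type*} [Fintype M] (c : ℝ) (v : M → M → ℝ)
    (ρstar ρ xstar x : M → ℝ) (K : M)
    (hρbal : c * (ρ K - ρstar K)
        + ∑ L, (max (v K L) 0 * ρ K - (- min (v K L) 0) * ρ L) = 0)
    (hρxbal : c * (ρ K * x K - ρstar K * xstar K)
        + ∑ L, (max (v K L) 0 * (ρ K * x K) - (- min (v K L) 0) * (ρ L * x L)) = 0) :
    c * ρstar K * (x K - xstar K) + ∑ L, (- min (v K L) 0) * ρ L * (x K - x L) = 0 := by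
  have hsum : ∑ L, (- min (v K L) 0) * ρ L * (x K - x L)
      = ∑ L, (max (v K L) 0 * (ρ K * x K) - (- min (v K L) 0) * (ρ L * x L))
        - x K * ∑ L, (max (v K L) 0 * ρ K - (- min (v K L) 0) * ρ L) := by
    rw [Finset.mul_sum, ← Finset.sum_sub_distrib]
    exact Finset.sum_congr rfl fun L _ => by ring
  rw [hsum]
  linear_combination hρxbal - x K * hρbal

/-- If `x` and `xstar` are related by a balance with nonnegative exchange coefficients, then `x`
is bounded above by the maximum of `xstar`. -/
theorem le_sup'_of_exchange_balance {M : Type*} [Fintype M] [Nonempty M]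
    (m : M → ℝ) (hm : ∀ K, 0 < m K) (w : M → M → ℝ) (hw : ∀ K L, 0 ≤ w K L)
    (xstar x : M → ℝ)
    (h : ∀ K, m K * (x K - xstar K) + ∑ L, w K L * (x K - x L) = 0) (K : M) :
    x K ≤ Finset.univ.sup' Finset.univ_nonempty xstar := by
  obtain ⟨J, hJ⟩ := Finite.exists_max x
  have hsum : 0 ≤ ∑ L, w J L * (x J - x L) :=
    Finset.sum_nonneg fun L _ => mul_nonneg (hw J L) (sub_nonneg.2 (hJ L))
  have hle : x J ≤ xstar J := by
    by_contra! hlt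
    linarith [h J, mul_pos (hm J) (sub_pos.2 hlt)]
  exact (hJ K).trans (hle.trans (Finset.le_sup' xstar (Finset.mem_univ J)))

/-- If `x` and `xstar` are related by a balance with nonnegative exchange coefficients, then `x`
is bounded below by the minimum of `xstar`. -/
theorem inf'_le_of_exchange_balance {M : Type*} [Fintype M] [Nonempty M]
    (m : M → ℝ) (hm : ∀ K, 0 < m K) (w : M → M → ℝ) (hw : ∀ K L, 0 ≤ w K L)
    (xstar x : M → ℝ)
    (h : ∀ K, m K * (x K - xstar K) + ∑ L, w K L * (x K - x L) = 0) (K : M) :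
    Finset.univ.inf' Finset.univ_nonempty xstar ≤ x K := by
  obtain ⟨J, hJ⟩ := Finite.exists_min x
  have hsum : ∑ L, w J L * (x J - x L) ≤ 0 :=
    Finset.sum_nonpos fun L _ => mul_nonpos_of_nonneg_of_nonpos (hw J L) (sub_nonpos.2 (hJ L))
  have hle : xstar J ≤ x J := by
    by_contra! hlt
    linarith [h J, mul_neg_of_pos_of_neg (hm J) (sub_neg.2 hlt)]
  exact (Finset.inf'_le xstar (Finset.mem_univ J)).trans (hle.trans (hJ K))

/-- Lemma A.2 of the paper (Larrouturou's discrete maximum principle). If the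
positive densities `ρ*`, `ρ` satisfy the upwind discrete mass balance, and
`(ρ x)` satisfies the corresponding upwind balance with initial data
`(ρ* x*)`, then `x` satisfies a discrete maximum principle with respect to
`x*`. -/
theorem discrete_maximum_principle
    {M : Type*} [Fintype M] [Nonempty M]
    (vol : M → ℝ) (hvol : ∀ K, 0 < vol K)
    (δt : ℝ) (hδt : 0 < δt)
    (v : M → M → ℝ) (hv : ∀ K L, v K L = - v L K)
    (ρstar ρ : M → ℝ) (hρstar : ∀ K, 0 < ρstar K) (hρ : ∀ K, 0 < ρ K)
    (xstar x : M → ℝ)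
    (hρbal : ∀ K, vol K / δt * (ρ K - ρstar K)
        + ∑ L, (max (v K L) 0 * ρ K - (- min (v K L) 0) * ρ L) = 0)
    (hρxbal : ∀ K, vol K / δt * (ρ K * x K - ρstar K * xstar K)
        + ∑ L, (max (v K L) 0 * (ρ K * x K) - (- min (v K L) 0) * (ρ L * x L)) = 0) :
    ∀ K, Finset.univ.inf' Finset.univ_nonempty xstar ≤ x K
      ∧ x K ≤ Finset.univ.sup' Finset.univ_nonempty xstar := by
  have hm : ∀ K, 0 < vol K / δt * ρstar K := fun K =>
    mul_pos (div_pos (hvol K) hδt) (hρstar K)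
  have hw : ∀ K L, 0 ≤ (- min (v K L) 0) * ρ L := fun K L =>
    mul_nonneg (neg_nonneg.2 (min_le_right _ _)) (hρ L).le
  have h := fun K => upwind_transport_eq (vol K / δt) v ρstar ρ xstar x K (hρbal K) (hρxbal K)
  exact fun K => ⟨inf'_le_of_exchange_balance _ hm _ hw xstar x h K,
    le_sup'_of_exchange_balance _ hm _ hw xstar x h K⟩
end
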